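/- Let P ⊆ ℝⁿ be a bounded convex set of positive Lebesgue measure. For every 0 < ε ≤ 1 there is a number D > 0 such that for all real numbers d > D one has ((1−ε)d·S_P) ∩ ℕⁿ ⊆ E_{d·P ∩ ℤⁿ} ⊆ (d·S_P) ∩ ℕⁿ. -/

import Mathlib

open MvPolynomial

/-- A monomial order on ℕⁿ: a linear order (total, antisymmetric, transitive)
that is a well-order and is compatible with addition. -/
def IsMonomialOrder (n : ℕ) (r : (Fin n → ℕ) → (Fin n → ℕ) → Prop) : Prop :=
  (∀ a b, r a b ∨ r b a) ∧
  (∀ a b, r a b → r b a → a = b) ∧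
  (∀ a b c, r a b → r b c → r a c) ∧
  WellFounded (fun a b => r a b ∧ a ≠ b) ∧
  (∀ a b c, r a b → r (a + c) (b + c))

/-- `e` is the exponent of the leading monomial of `p` w.r.t. the monomial order `r`. -/
def IsLeadMon {n : ℕ} (r : (Fin n → ℕ) → (Fin n → ℕ) → Prop)
    (p : MvPolynomial (Fin n) ℝ) (e : Fin n → ℕ) : Prop :=
  (∃ d ∈ p.support, ⇑d = e) ∧ ∀ d ∈ p.support, r (⇑d) e

/-- `E_A`: the set of exponents `e` such that no (nonzero) polynomial vanishing on `A`
has leading monomial `X^e`. -/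
def ESet {n : ℕ} (r : (Fin n → ℕ) → (Fin n → ℕ) → Prop)
    (A : Set (Fin n → ℝ)) : Set (Fin n → ℕ) :=
  {e | ¬ ∃ p : MvPolynomial (Fin n) ℝ, (∀ a ∈ A, eval a p = 0) ∧ IsLeadMon r p e}

open Pointwise MeasureTheory

/-- The lattice `ℤⁿ` viewed as a subset of `ℝⁿ`. -/
def latticePoints (n : ℕ) : Set (Fin n → ℝ) := {x | ∀ i, ∃ m : ℤ, x i = (m : ℝ)}

/-- `S_P`: the closure of the increasing union `⋃ₖ 2⁻ᵏ·E_{2ᵏ·P ∩ ℤⁿ}`,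
viewing each `E_{2ᵏ·P ∩ ℤⁿ} ⊆ ℕⁿ` as a subset of `ℝⁿ`. -/
noncomputable def SP {n : ℕ} (r : (Fin n → ℕ) → (Fin n → ℕ) → Prop)
    (P : Set (Fin n → ℝ)) : Set (Fin n → ℝ) :=
  closure (⋃ k : ℕ,
    (fun (e : Fin n → ℕ) (i : Fin n) => (e i : ℝ) / 2 ^ k) ''
      ESet r (((2 ^ k : ℝ) • P) ∩ latticePoints n))

namespace IsMonomialOrder

variable {n : ℕ} {r : (Fin n → ℕ) → (Fin n → ℕ) → Prop}

theorem zero_le (hr : IsMonomialOrder n r) (c : Fin n → ℕ) : r 0 c := by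
  obtain ⟨htot, hanti, -, hwf, hadd⟩ := hr
  by_contra h
  have hc : r c 0 := (htot 0 c).resolve_left h
  have hc0 : c ≠ 0 := by
    rintro rfl
    exact h hc
  obtain ⟨m, ⟨k, rfl⟩, hm⟩ := hwf.has_min (Set.range fun k : ℕ => k • c) ⟨_, 0, rfl⟩
  refine hm ((k + 1) • c) ⟨k + 1, rfl⟩ ⟨?_, ?_⟩
  · have := hadd c 0 (k • c)
    rw [zero_add, add_comm, ← succ_nsmul] at this
    exact this hc
  · intro h'
    rw [succ_nsmul] at h'
    exact hc0 (by simpa using h')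

theorem of_le (hr : IsMonomialOrder n r) {a b : Fin n → ℕ} (h : a ≤ b) : r a b := by
  have := hr.2.2.2.2 0 (b - a) a (hr.zero_le _)
  rwa [zero_add, tsub_add_cancel_of_le h] at this

theorem rel_of_not_lt (hr : IsMonomialOrder n r) {a b : Fin n → ℕ} (h : ¬ (r a b ∧ a ≠ b)) :
    r b a := by
  by_cases hab : a = b
  · exact hr.of_le hab.ge
  · exact (hr.1 a b).resolve_left fun h' => h ⟨h', hab⟩

end IsMonomialOrder

/-- The monomial function `a ↦ a ^ e` on `ℝⁿ`. -/
def monomialFun {n : ℕ} (e : Fin n → ℕ) (a : Fin n → ℝ) : ℝ := ∏ i, a i ^ e i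

theorem eval_eq_sum_monomialFun {n : ℕ} (p : MvPolynomial (Fin n) ℝ) (a : Fin n → ℝ) :
    eval a p = ∑ g ∈ p.support, p.coeff g * monomialFun (⇑g) a :=
  MvPolynomial.eval_eq' a p

theorem monomialFun_add {n : ℕ} (g : Fin n → ℕ) (a b : Fin n → ℝ) :
    monomialFun g (a + b) = ∑ k ∈ Fintype.piFinset fun i => Finset.range (g i + 1),
      (∏ i, ((g i).choose (k i) : ℝ)) * (monomialFun k a * monomialFun (g - k) b) := by
  simp only [monomialFun, Pi.add_apply, add_pow, Finset.prod_univ_sum, Pi.sub_apply,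
    ← Finset.prod_mul_distrib]
  refine Finset.sum_congr rfl fun k _ => Finset.prod_congr rfl fun i _ => ?_
  ring

section ESet

variable {n : ℕ} {r : (Fin n → ℕ) → (Fin n → ℕ) → Prop}

theorem ESet_mono {A B : Set (Fin n → ℝ)} (h : A ⊆ B) : ESet r A ⊆ ESet r B :=
  fun _ he ⟨p, hp, hl⟩ => he ⟨p, fun a ha => hp a (h ha), hl⟩

theorem ESet_of_le (hr : IsMonomialOrder n r) {A : Set (Fin n → ℝ)} {e f : Fin n → ℕ}
    (h : f ≤ e) (he : e ∈ ESet r A) : f ∈ ESet r A := by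
  rintro ⟨p, hp, ⟨d, hd, rfl⟩, hl⟩
  refine he ⟨p * monomial (Finsupp.equivFunOnFinite.symm (e - ⇑d)) 1, fun a ha => by
    simp [hp a ha], ⟨d + Finsupp.equivFunOnFinite.symm (e - ⇑d), ?_, ?_⟩, ?_⟩
  · rw [mem_support_iff, coeff_mul_monomial, mul_one]
    exact mem_support_iff.1 hd
  · ext i
    simpa using Nat.add_sub_of_le (h i)
  · intro g hg
    rw [mem_support_iff, coeff_mul_monomial'] at hg
    split_ifs at hg with hle
    · rw [mul_one] at hg
      have := hr.2.2.2.2 _ _ (e - ⇑d) (hl _ (mem_support_iff.2 hg))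
      rw [add_tsub_cancel_of_le h] at this
      convert this using 1
      ext i
      simpa using (Nat.sub_add_cancel (hle i)).symm
    · exact absurd rfl hg

/-- Exponents in `ESet r A` are detected by a linear functional supported on `A`. -/
theorem exists_dual_of_mem_ESet {A : Set (Fin n → ℝ)} {e : Fin n → ℕ} (hr : IsMonomialOrder n r)
    (he : e ∈ ESet r A) :
    ∃ φ : Module.Dual ℝ ((Fin n → ℝ) → ℝ), (∀ h, (∀ a ∈ A, h a = 0) → φ h = 0) ∧
      (∀ f, r f e ∧ f ≠ e → φ (monomialFun f) = 0) ∧ φ (monomialFun e) ≠ 0 := by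
  let V : Submodule ℝ ((Fin n → ℝ) → ℝ) :=
    { carrier := {h | ∀ a ∈ A, h a = 0}
      add_mem' := fun hx hy a ha => by simp [hx a ha, hy a ha]
      zero_mem' := fun a _ => rfl
      smul_mem' := fun c x hx a ha => by simp [hx a ha] }
  let W : Submodule ℝ ((Fin n → ℝ) → ℝ) :=
    Submodule.span ℝ (monomialFun '' {f | r f e ∧ f ≠ e})
  have hnot : monomialFun e ∉ V ⊔ W := by
    intro hmem
    obtain ⟨v, hv, w, hw, hvw⟩ := Submodule.mem_sup.1 hmem
    obtain ⟨c, hc, hcw⟩ := (Finsupp.mem_span_image_iff_linearCombination ℝ).1 hw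
    let F : (Fin n → ℕ) → (Fin n →₀ ℕ) := Finsupp.equivFunOnFinite.symm
    have hF : ∀ x y, F x = F y ↔ x = y := fun x y => Finsupp.equivFunOnFinite.symm.injective.eq_iff
    let p : MvPolynomial (Fin n) ℝ := monomial (F e) 1 - ∑ f ∈ c.support, monomial (F f) (c f)
    have hcoeff : ∀ g : Fin n → ℕ, p.coeff (F g) = (if g = e then 1 else 0) - c g := by
      intro g
      simp only [p, coeff_sub, coeff_monomial, coeff_sum, hF, Finset.sum_ite_eq', eq_comm (a := e)]
      congr 1
      split_ifs with hg
      · rfl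
      · exact (Finsupp.notMem_support_iff.1 hg).symm
    have hce : c e = 0 := by
      by_contra hne
      exact (hc (Finsupp.mem_support_iff.2 hne)).2 rfl
    refine he ⟨p, fun a ha => ?_, ⟨F e, ?_, rfl⟩, ?_⟩
    · have h1 := congrFun hvw a
      have h2 := congrFun hcw a
      simp only [Pi.add_apply, hv a ha, zero_add] at h1
      rw [h1, Finsupp.linearCombination_apply, Finsupp.sum, Finset.sum_apply] at h2
      have hev : ∀ (f : Fin n → ℕ) (x : ℝ), eval a (monomial (F f) x) = x * monomialFun f a := by
        intro f x
        rw [eval_monomial, Finsupp.prod_fintype _ _ fun i => pow_zero _]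
        rfl
      simp only [p, map_sub, map_sum, hev, one_mul, ← h2, Pi.smul_apply, smul_eq_mul, sub_self]
    · rw [mem_support_iff, hcoeff, hce]
      simp
    · intro d hd
      have hd' : F (⇑d) = d := Finsupp.equivFunOnFinite.symm_apply_apply d
      rw [mem_support_iff, ← hd', hcoeff] at hd
      by_cases hde : ⇑d = e
      · exact hr.of_le hde.le
      · rw [if_neg hde, zero_sub, neg_ne_zero] at hd
        exact (hc (Finsupp.mem_support_iff.2 hd)).1
  obtain ⟨φ, hφ, hker⟩ := Submodule.exists_le_ker_of_notMem hnot
  exact ⟨φ, fun h hh => hker (Submodule.mem_sup_left (S := V) hh),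
    fun f hf => hker (Submodule.mem_sup_right (Submodule.subset_span ⟨f, hf, rfl⟩)), hφ⟩

theorem add_mem_ESet (hr : IsMonomialOrder n r) {A B : Set (Fin n → ℝ)} {e f : Fin n → ℕ}
    (he : e ∈ ESet r A) (hf : f ∈ ESet r B) : e + f ∈ ESet r (A + B) := by
  obtain ⟨φ, hφA, hφ, hφe⟩ := exists_dual_of_mem_ESet hr he
  obtain ⟨ψ, hψB, hψ, hψf⟩ := exists_dual_of_mem_ESet hr hf
  rintro ⟨p, hp, ⟨d, hd, hde⟩, hl⟩
  have hzero : φ (fun a => ψ fun b => eval (a + b) p) = 0 :=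
    hφA _ fun a ha => hψB _ fun b hb => hp _ (Set.add_mem_add ha hb)
  let S : (Fin n →₀ ℕ) → Finset (Fin n → ℕ) := fun g =>
    Fintype.piFinset fun i => Finset.range (g i + 1)
  have hin : ∀ a, (fun b => eval (a + b) p) = ∑ g ∈ p.support, ∑ k ∈ S g,
      (p.coeff g * (∏ i, ((g i).choose (k i) : ℝ)) * monomialFun k a) •
        monomialFun (⇑g - k) := by
    intro a
    ext b
    simp only [eval_eq_sum_monomialFun, monomialFun_add, Finset.mul_sum, Finset.sum_apply,
      Pi.smul_apply, smul_eq_mul, S]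
    refine Finset.sum_congr rfl fun g _ => Finset.sum_congr rfl fun k _ => by ring
  have hout : (fun a => ψ fun b => eval (a + b) p) = ∑ g ∈ p.support, ∑ k ∈ S g,
      (p.coeff g * (∏ i, ((g i).choose (k i) : ℝ)) * ψ (monomialFun (⇑g - k))) •
        monomialFun k := by
    ext a
    rw [hin a]
    simp only [map_sum, map_smul, Finset.sum_apply, Pi.smul_apply, smul_eq_mul]
    refine Finset.sum_congr rfl fun g _ => Finset.sum_congr rfl fun k _ => by ring
  rw [hout] at hzero
  simp only [map_sum, map_smul, smul_eq_mul] at hzero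
  have hkey : ∀ g ∈ p.support, ∀ k ∈ S g, (g ≠ d ∨ k ≠ e) →
      p.coeff g * (∏ i, ((g i).choose (k i) : ℝ)) * ψ (monomialFun (⇑g - k)) *
        φ (monomialFun k) = 0 := by
    intro g hg k hk hne
    have hkg : k ≤ ⇑g := fun i =>
      Nat.lt_succ_iff.1 (Finset.mem_range.1 (Fintype.mem_piFinset.1 hk i))
    by_cases h1 : r k e ∧ k ≠ e
    · rw [hφ _ h1, mul_zero]
    by_cases h2 : r (⇑g - k) f ∧ ⇑g - k ≠ f
    · rw [hψ _ h2, mul_zero, zero_mul]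
    exfalso
    have h1' := hr.2.2.2.2 _ _ f (hr.rel_of_not_lt h1)
    have h2' := hr.2.2.2.2 _ _ k (hr.rel_of_not_lt h2)
    rw [tsub_add_cancel_of_le hkg, add_comm f k] at h2'
    have hge : ⇑g = e + f := hr.2.1 _ _ (hl g hg) (hr.2.2.1 _ _ _ h1' h2')
    rw [hge] at h2'
    have hke : k + f = e + f := hr.2.1 _ _ h2' h1'
    rcases hne with hne | hne
    · exact hne (DFunLike.coe_injective (hge.trans hde.symm))
    · exact hne (add_right_cancel hke)
  have heS : e ∈ S d := by
    refine Fintype.mem_piFinset.2 fun i => Finset.mem_range.2 ?_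
    have := congrFun hde i
    rw [Pi.add_apply] at this
    omega
  rw [Finset.sum_eq_single_of_mem d hd
      fun g hg hgd => Finset.sum_eq_zero fun k hk => hkey g hg k hk (Or.inl hgd),
    Finset.sum_eq_single_of_mem e heS fun k hk hke => hkey d hd k hk (Or.inr hke)] at hzero
  refine mul_ne_zero (mul_ne_zero (mul_ne_zero (mem_support_iff.1 hd) ?_) ?_) hφe hzero
  · refine Finset.prod_ne_zero_iff.2 fun i _ => Nat.cast_ne_zero.2 (Nat.choose_pos ?_).ne'
    have := Finset.mem_range.1 (Fintype.mem_piFinset.1 heS i)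
    omega
  · rwa [hde, add_tsub_cancel_left]

theorem zero_mem_ESet (hr : IsMonomialOrder n r) {A : Set (Fin n → ℝ)} (hA : A.Nonempty) :
    (0 : Fin n → ℕ) ∈ ESet r A := by
  rintro ⟨p, hp, ⟨d, hd, hd0⟩, hl⟩
  obtain ⟨a, ha⟩ := hA
  have hall : ∀ g ∈ p.support, ⇑g = 0 := fun g hg => hr.2.1 _ _ (hl g hg) (hr.zero_le _)
  have h := hp a ha
  rw [eval_eq_sum_monomialFun, Finset.sum_eq_single_of_mem d hd fun g hg hgd =>
    absurd (DFunLike.coe_injective ((hall g hg).trans hd0.symm)) hgd, hd0] at h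
  exact mem_support_iff.1 hd (by simpa [monomialFun] using h)

/-- The lattice points of the box `∏ᵢ [0, vᵢ]`. -/
def latticeBox (v : Fin n → ℕ) : Set (Fin n → ℝ) := {x | ∀ i, ∃ j ≤ v i, x i = (j : ℝ)}

theorem latticeBox_add (v w : Fin n → ℕ) :
    latticeBox v + latticeBox w ⊆ latticeBox (v + w) := by
  rintro _ ⟨x, hx, y, hy, rfl⟩ i
  obtain ⟨j, hj, hxj⟩ := hx i
  obtain ⟨k, hk, hyk⟩ := hy i
  exact ⟨j + k, add_le_add hj hk, by simp [hxj, hyk]⟩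

theorem single_mem_ESet_latticeBox (hr : IsMonomialOrder n r) (i : Fin n) :
    Pi.single i 1 ∈ ESet r (latticeBox (Pi.single i 1)) := by
  rintro ⟨p, hp, ⟨d, hd, hdi⟩, hl⟩
  have h0 := hp 0 fun j => ⟨0, Nat.zero_le _, by simp⟩
  have h1 := hp (Pi.single i 1) fun j => ⟨(Pi.single i 1 : Fin n → ℕ) j, le_rfl, by
    by_cases h : j = i
    · subst h
      simp
    · simp [h]⟩
  have hsub : eval (Pi.single i 1) p - eval 0 p = p.coeff d := by
    rw [eval_eq_sum_monomialFun, eval_eq_sum_monomialFun, ← Finset.sum_sub_distrib,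
      Finset.sum_eq_single_of_mem d hd]
    · rw [← mul_sub, hdi]
      have e1 : monomialFun (Pi.single i 1) (Pi.single i (1 : ℝ)) = 1 :=
        Finset.prod_eq_one fun j _ => by
          by_cases h : j = i
          · subst h
            simp
          · simp [h]
      have e0 : monomialFun (Pi.single i 1) (0 : Fin n → ℝ) = 0 :=
        Finset.prod_eq_zero (Finset.mem_univ i) (by simp)
      rw [e1, e0, sub_zero, mul_one]
    · intro g hg hgd
      have hgi : g i = 0 := by
        by_contra hne
        refine hgd (DFunLike.coe_injective ((hr.2.1 _ _ (hl g hg) (hr.of_le ?_)).trans hdi.symm))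
        intro j
        by_cases h : j = i
        · subst h
          simpa using Nat.one_le_iff_ne_zero.2 hne
        · simp [h]
      rw [← mul_sub, mul_eq_zero]
      refine Or.inr (sub_eq_zero.2 (Finset.prod_congr rfl fun j _ => ?_))
      by_cases h : j = i
      · subst h
        simp [hgi]
      · simp [h]
  rw [h0, h1, sub_zero] at hsub
  exact mem_support_iff.1 hd hsub.symm

theorem mem_ESet_latticeBox (hr : IsMonomialOrder n r) (v : Fin n → ℕ) :
    v ∈ ESet r (latticeBox v) := by
  let M : AddSubmonoid (Fin n → ℕ) :=
    { carrier := {v | v ∈ ESet r (latticeBox v)}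
      add_mem' := fun {v w} hv hw => ESet_mono (latticeBox_add v w) (add_mem_ESet hr hv hw)
      zero_mem' := zero_mem_ESet hr ⟨0, fun i => ⟨0, le_rfl, by simp⟩⟩ }
  have hv : v = ∑ i, v i • (Pi.single i 1 : Fin n → ℕ) := by
    conv_lhs => rw [← Finset.univ_sum_single v]
    refine Finset.sum_congr rfl fun i _ => ?_
    rw [← Pi.single_smul, smul_eq_mul, mul_one]
  change v ∈ M
  rw [hv]
  exact sum_mem fun i _ => nsmul_mem (S := M) (single_mem_ESet_latticeBox hr i) _

theorem apply_le_of_mem_ESet (hr : IsMonomialOrder n r) {A : Set (Fin n → ℝ)} {i : Fin n}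
    (s : Finset ℝ) (hA : ∀ a ∈ A, a i ∈ s) {e : Fin n → ℕ} (he : e ∈ ESet r A) :
    e i < s.card := by
  by_contra! hle
  have hle' : Pi.single i s.card ≤ e := by
    intro j
    by_cases h : j = i
    · subst h
      simpa using hle
    · simp [h]
  let q : Polynomial ℝ := ∏ x ∈ s, (Polynomial.X - Polynomial.C x)
  have hq : q.Monic := Polynomial.monic_prod_of_monic _ _ fun x _ => Polynomial.monic_X_sub_C x
  have hdeg : q.natDegree = s.card := by
    rw [Polynomial.natDegree_prod_of_monic _ _ fun x _ => Polynomial.monic_X_sub_C x]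
    simp
  let p : MvPolynomial (Fin n) ℝ :=
    ∑ k ∈ Finset.range (q.natDegree + 1), monomial (Finsupp.single i k) (q.coeff k)
  refine ESet_of_le hr hle' he ⟨p, fun a ha => ?_, ⟨Finsupp.single i s.card, ?_, ?_⟩, ?_⟩
  · have : eval a p = q.eval (a i) := by
      simp [p, Polynomial.eval_eq_sum_range, eval_monomial]
    rw [this, Polynomial.eval_prod]
    exact Finset.prod_eq_zero (hA a ha) (by simp)
  · have : p.coeff (Finsupp.single i s.card) = 1 := by
      simp only [p, coeff_sum, coeff_monomial, (Finsupp.single_injective i).eq_iff]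
      rw [Finset.sum_ite_eq', if_pos (by simp [hdeg]), ← hdeg]
      exact hq
    rw [mem_support_iff, this]
    exact one_ne_zero
  · exact Finsupp.single_eq_pi_single _ _
  · intro d hd
    rw [mem_support_iff, coeff_sum] at hd
    obtain ⟨k, hk, hkd⟩ := Finset.exists_ne_zero_of_sum_ne_zero hd
    rw [coeff_monomial] at hkd
    split_ifs at hkd with h
    · subst h
      refine hr.of_le ?_
      rw [Finsupp.single_eq_pi_single]
      rw [Finset.mem_range, hdeg] at hk
      exact Pi.single_mono i (by omega)
    · exact absurd rfl hkd

end ESet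

theorem Convex.interior_nonempty_of_volume_pos {n : ℕ} {P : Set (Fin n → ℝ)} (hc : Convex ℝ P)
    (hv : 0 < volume P) : (interior P).Nonempty := by
  rw [hc.interior_nonempty_iff_affineSpan_eq_top]
  by_contra h
  exact hv.ne' (measure_mono_null (subset_affineSpan ℝ P) (Measure.addHaar_affineSubspace _ _ h))

section Dilates

variable {n : ℕ} {r : (Fin n → ℕ) → (Fin n → ℕ) → Prop} {P : Set (Fin n → ℝ)}

theorem add_mem_ESet_dilate (hr : IsMonomialOrder n r) (hc : Convex ℝ P) {s t : ℝ} (hs : 0 ≤ s)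
    (ht : 0 ≤ t) {e f : Fin n → ℕ} (he : e ∈ ESet r ((s • P) ∩ latticePoints n))
    (hf : f ∈ ESet r ((t • P) ∩ latticePoints n)) :
    e + f ∈ ESet r (((s + t) • P) ∩ latticePoints n) := by
  refine ESet_mono ?_ (add_mem_ESet hr he hf)
  rintro _ ⟨x, ⟨hx, hx'⟩, y, ⟨hy, hy'⟩, rfl⟩
  refine ⟨?_, fun i => ?_⟩
  · rw [hc.add_smul hs ht]
    exact Set.add_mem_add hx hy
  · obtain ⟨j, hj⟩ := hx' i
    obtain ⟨k, hk⟩ := hy' i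
    exact ⟨j + k, by simp [hj, hk]⟩

theorem nsmul_add_mem_ESet_dilate (hr : IsMonomialOrder n r) (hc : Convex ℝ P) {s t : ℝ}
    (hs : 0 ≤ s) (ht : 0 ≤ t) {e f : Fin n → ℕ} (he : e ∈ ESet r ((s • P) ∩ latticePoints n))
    (hf : f ∈ ESet r ((t • P) ∩ latticePoints n)) (m : ℕ) :
    m • e + f ∈ ESet r (((m * s + t) • P) ∩ latticePoints n) := by
  induction m with
  | zero => simpa using hf
  | succ m ih =>
    have := add_mem_ESet_dilate hr hc hs (by positivity) he ih
    rwa [← add_assoc, ← add_assoc, ← succ_nsmul', ← one_add_mul, add_comm 1 (m : ℝ),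
      ← Nat.cast_succ] at this

theorem const_mem_ESet_dilate (hr : IsMonomialOrder n r) {x : Fin n → ℝ} {ρ : ℝ} (hρ : 0 < ρ)
    (hP : Metric.closedBall x ρ ⊆ P) {t : ℝ} {N : ℕ} (hN : (N : ℝ) + 1 ≤ 2 * ρ * t) :
    (fun _ => N) ∈ ESet r ((t • P) ∩ latticePoints n) := by
  have ht : 0 < t := by
    by_contra! h
    nlinarith [Nat.cast_nonneg (α := ℝ) N]
  let c : Fin n → ℤ := fun i => ⌈t * x i - t * ρ⌉
  have h0 : (0 : Fin n → ℕ) ∈ ESet r {fun i => (c i : ℝ)} :=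
    zero_mem_ESet hr (Set.singleton_nonempty _)
  have := add_mem_ESet hr h0 (mem_ESet_latticeBox hr fun _ => N)
  rw [zero_add] at this
  refine ESet_mono ?_ this
  rintro _ ⟨_, rfl, y, hy, rfl⟩
  refine ⟨(Set.mem_smul_set_iff_inv_smul_mem₀ ht.ne' _ _).2 (hP ?_), fun i => ?_⟩
  · rw [Metric.mem_closedBall, dist_pi_le_iff hρ.le]
    intro i
    obtain ⟨j, hj, hyj⟩ := hy i
    have hj' : (j : ℝ) ≤ N := Nat.cast_le.2 hj
    have hj0 : (0 : ℝ) ≤ j := Nat.cast_nonneg j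
    have h1 := Int.le_ceil (t * x i - t * ρ)
    have h2 := Int.ceil_lt_add_one (t * x i - t * ρ)
    have habs : |((c i : ℝ) + y i) - t * x i| ≤ t * ρ := by
      rw [abs_le, hyj]
      constructor <;> simp only [c] <;> linarith
    have heq : (t⁻¹ • ((fun i => (c i : ℝ)) + y)) i - x i
        = t⁻¹ * (((c i : ℝ) + y i) - t * x i) := by
      simp only [Pi.smul_apply, Pi.add_apply, smul_eq_mul]
      field_simp
    rw [Real.dist_eq, heq, abs_mul, abs_of_pos (inv_pos.2 ht), inv_mul_le_iff₀ ht]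
    exact habs
  · obtain ⟨j, -, hyj⟩ := hy i
    exact ⟨c i + j, by simp [hyj]⟩

theorem apply_le_of_mem_ESet_dilate (hr : IsMonomialOrder n r) {R : ℝ}
    (hP : ∀ x ∈ P, ‖x‖ ≤ R) (hR : 0 ≤ R) {d : ℝ} (hd : 0 ≤ d) {e : Fin n → ℕ}
    (he : e ∈ ESet r ((d • P) ∩ latticePoints n)) (i : Fin n) : (e i : ℝ) ≤ 2 * R * d := by
  have hRd : 0 ≤ d * R := by positivity
  let M : ℤ := ⌊d * R⌋
  have hM : 0 ≤ M := Int.floor_nonneg.2 hRd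
  have hlt := apply_le_of_mem_ESet hr (i := i) ((Finset.Icc (-M) M).image ((↑) : ℤ → ℝ)) ?_ he
  · have hcard := hlt.trans_le Finset.card_image_le
    rw [Int.card_Icc] at hcard
    have h1 : (e i : ℤ) ≤ 2 * M := by omega
    have h2 : (e i : ℝ) ≤ 2 * M := by exact_mod_cast h1
    have h3 : (M : ℝ) ≤ d * R := Int.floor_le _
    linarith
  · rintro _ ⟨⟨y, hy, rfl⟩, ha⟩
    obtain ⟨m, hm⟩ := ha i
    have habs : |(d • y) i| ≤ d * R := by
      rw [Pi.smul_apply, smul_eq_mul, abs_mul, abs_of_nonneg hd]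
      exact mul_le_mul_of_nonneg_left ((norm_le_pi_norm y i).trans (hP y hy)) hd
    refine Finset.mem_image.2 ⟨m, Finset.mem_Icc.2 ?_, hm.symm⟩
    change (d • y) i = m at hm
    rw [hm, abs_le] at habs
    refine ⟨?_, Int.le_floor.2 habs.2⟩
    have : -m ≤ M := Int.le_floor.2 (by push_cast; linarith)
    omega

theorem mem_smul_SP_of_mem_ESet (hr : IsMonomialOrder n r) (hc : Convex ℝ P) {x : Fin n → ℝ}
    {ρ : ℝ} (hρ : 0 < ρ) (hP : Metric.closedBall x ρ ⊆ P) {d : ℝ} (hd : 0 < d) {e : Fin n → ℕ}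
    (he : e ∈ ESet r ((d • P) ∩ latticePoints n)) :
    (fun i => (e i : ℝ)) ∈ d • SP r P := by
  rw [Set.mem_smul_set_iff_inv_smul_mem₀ hd.ne']
  let t₀ : ℝ := 1 / (2 * ρ)
  have ht₀ : 0 < t₀ := by positivity
  let m : ℕ → ℕ := fun k => ⌊(2 ^ k - t₀) / d⌋₊
  have hpow : Filter.Tendsto (fun k : ℕ => (2 : ℝ) ^ k) Filter.atTop Filter.atTop :=
    tendsto_pow_atTop_atTop_of_one_lt one_lt_two
  have hlarge : ∀ᶠ k : ℕ in Filter.atTop, t₀ ≤ (2 : ℝ) ^ k := hpow.eventually_ge_atTop t₀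
  have hlim : Filter.Tendsto (fun k => (m k : ℝ) / 2 ^ k) Filter.atTop (nhds d⁻¹) := by
    have hinv : Filter.Tendsto (fun k : ℕ => ((2 : ℝ) ^ k)⁻¹) Filter.atTop (nhds 0) :=
      tendsto_inv_atTop_zero.comp hpow
    refine tendsto_of_tendsto_of_tendsto_of_le_of_le' (g := fun k : ℕ =>
      d⁻¹ - (t₀ / d + 1) * ((2 : ℝ) ^ k)⁻¹) (h := fun _ => d⁻¹) ?_ tendsto_const_nhds ?_ ?_
    · simpa using (hinv.const_mul (t₀ / d + 1)).const_sub d⁻¹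
    · filter_upwards with k
      have h := Nat.lt_floor_add_one ((2 ^ k - t₀) / d)
      have h2 : (0 : ℝ) < 2 ^ k := by positivity
      rw [le_div_iff₀ h2, sub_mul, mul_assoc, inv_mul_cancel₀ h2.ne', mul_one]
      have : ((2 : ℝ) ^ k - t₀) / d = d⁻¹ * 2 ^ k - t₀ / d := by ring
      simp only [m]
      linarith
    · filter_upwards [hlarge] with k hk
      have h2 : (0 : ℝ) < 2 ^ k := by positivity
      rw [div_le_iff₀ h2]
      refine (Nat.floor_le (div_nonneg (sub_nonneg.2 hk) hd.le)).trans ?_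
      rw [inv_mul_eq_div]
      gcongr
      linarith
  refine mem_closure_of_tendsto (f := fun k i => (((m k • e) i : ℕ) : ℝ) / 2 ^ k)
    (b := Filter.atTop) ?_ ?_
  · refine tendsto_pi_nhds.2 fun i => ?_
    have := hlim.mul_const (e i : ℝ)
    refine this.congr fun k => ?_
    simp only [Pi.smul_apply, smul_eq_mul, Nat.cast_mul]
    ring
  · filter_upwards [hlarge] with k hk
    refine Set.mem_iUnion.2 ⟨k, m k • e, ?_, rfl⟩
    have hmd : (m k : ℝ) * d ≤ 2 ^ k - t₀ :=
      (le_div_iff₀ hd).1 (Nat.floor_le (div_nonneg (sub_nonneg.2 hk) hd.le))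
    have h0 : (fun _ => 0) ∈ ESet r (((2 ^ k - m k * d : ℝ) • P) ∩ latticePoints n) := by
      refine const_mem_ESet_dilate hr hρ hP ?_
      have h1 : 2 * ρ * t₀ = 1 := by
        simp only [t₀]
        field_simp
      have h2 : 2 * ρ * t₀ ≤ 2 * ρ * (2 ^ k - m k * d) := by
        gcongr
        linarith
      rw [Nat.cast_zero, zero_add]
      linarith
    have := nsmul_add_mem_ESet_dilate hr hc hd.le (by linarith) he h0 (m k)
    rw [add_sub_cancel] at this
    exact this

/-- Exponents not exceeding `(1 - ε) d (f / a)` by more than `ρ ε d` lie in `E_{dP ∩ ℤⁿ}` for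
large `d`, if `f ∈ E_{aP ∩ ℤⁿ}` and `P` contains a ball of radius `ρ`. -/
theorem eventually_mem_ESet_dilate (hr : IsMonomialOrder n r) (hc : Convex ℝ P) {x : Fin n → ℝ}
    {ρ : ℝ} (hρ : 0 < ρ) (hP : Metric.closedBall x ρ ⊆ P) {ε : ℝ} (hε0 : 0 < ε) (hε1 : ε ≤ 1)
    {a : ℝ} (ha : 0 < a) {f : Fin n → ℕ} (hf : f ∈ ESet r ((a • P) ∩ latticePoints n)) :
    ∀ᶠ d : ℝ in Filter.atTop, ∀ e : Fin n → ℕ,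
      (∀ i, (e i : ℝ) ≤ (1 - ε) * d * (f i / a) + ρ * ε * d) →
        e ∈ ESet r ((d • P) ∩ latticePoints n) := by
  let F : ℕ := ∑ i, f i
  have hF : ∀ i, f i ≤ F := fun i => Finset.single_le_sum (fun _ _ => Nat.zero_le _)
    (Finset.mem_univ i)
  have hρε : 0 < ρ * ε := mul_pos hρ hε0
  filter_upwards [Filter.eventually_ge_atTop ((F + 2) / (ρ * ε)), Filter.eventually_gt_atTop 0]
    with d hd hd0 e he
  rw [div_le_iff₀ hρε] at hd
  have h1ε : 0 ≤ (1 - ε) * d := mul_nonneg (by linarith) hd0.le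
  let m : ℕ := ⌊(1 - ε) * d / a⌋₊
  have hm : (m : ℝ) * a ≤ (1 - ε) * d :=
    (le_div_iff₀ ha).1 (Nat.floor_le (div_nonneg h1ε ha.le))
  have hm' : (1 - ε) * d / a ≤ m + 1 := (Nat.lt_floor_add_one _).le
  let N : ℕ := ⌈F + ρ * ε * d⌉₊
  have hN : (N : ℝ) < F + ρ * ε * d + 1 := Nat.ceil_lt_add_one (by positivity)
  have hN' : F + ρ * ε * d ≤ N := Nat.le_ceil _
  have hconst : (fun _ => N) ∈ ESet r (((d - m * a) • P) ∩ latticePoints n) := by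
    refine const_mem_ESet_dilate hr hρ hP ?_
    have : 2 * ρ * (ε * d) ≤ 2 * ρ * (d - m * a) := by
      gcongr
      linarith
    linarith
  have hmem := nsmul_add_mem_ESet_dilate hr hc ha.le (by nlinarith) hf hconst m
  rw [add_sub_cancel] at hmem
  refine ESet_of_le hr (fun i => ?_) hmem
  have h1 : (1 - ε) * d * (f i / a) ≤ (m + 1) * f i := by
    rw [mul_div_assoc', mul_div_right_comm]
    gcongr
  have h2 : (f i : ℝ) ≤ F := Nat.cast_le.2 (hF i)
  have h3 : (e i : ℝ) ≤ m * f i + N := by linarith [he i]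
  simp only [Pi.add_apply, Pi.smul_apply, smul_eq_mul]
  exact_mod_cast h3

end Dilates

/-- For every `0 < ε ≤ 1` there is `D > 0` such that for all `d > D`,
`((1−ε)d·S_P) ∩ ℕⁿ ⊆ E_{d·P ∩ ℤⁿ} ⊆ (d·S_P) ∩ ℕⁿ`. -/
theorem ESet_approx_SP {n : ℕ}
    (r : (Fin n → ℕ) → (Fin n → ℕ) → Prop) (hr : IsMonomialOrder n r)
    (P : Set (Fin n → ℝ)) (hb : Bornology.IsBounded P) (hc : Convex ℝ P)
    (hv : 0 < volume P) (ε : ℝ) (hε0 : 0 < ε) (hε1 : ε ≤ 1) :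
    ∃ D : ℝ, 0 < D ∧ ∀ d : ℝ, D < d →
      (∀ e : Fin n → ℕ, (fun i => (e i : ℝ)) ∈ ((1 - ε) * d) • SP r P →
        e ∈ ESet r ((d • P) ∩ latticePoints n)) ∧
      (∀ e ∈ ESet r ((d • P) ∩ latticePoints n),
        (fun i => (e i : ℝ)) ∈ d • SP r P) := by
  obtain ⟨x, hx⟩ := hc.interior_nonempty_of_volume_pos hv
  obtain ⟨ρ, hρ, hP⟩ := Metric.nhds_basis_closedBall.mem_iff.1 (mem_interior_iff_mem_nhds.1 hx)
  obtain ⟨R, hR, hPR⟩ := hb.exists_pos_norm_le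
  let U : Set (Fin n → ℝ) := ⋃ k : ℕ, (fun (e : Fin n → ℕ) (i : Fin n) => (e i : ℝ) / 2 ^ k) ''
    ESet r (((2 ^ k : ℝ) • P) ∩ latticePoints n)
  have hU : Bornology.IsBounded U := by
    refine isBounded_iff_forall_norm_le.2 ⟨2 * R, fun y hy => ?_⟩
    obtain ⟨k, f, hf, rfl⟩ := Set.mem_iUnion.1 hy
    refine (pi_norm_le_iff_of_nonneg (by positivity)).2 fun i => ?_
    have h2 : (0 : ℝ) < 2 ^ k := by positivity
    rw [Real.norm_of_nonneg (by positivity), div_le_iff₀ h2]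
    exact apply_le_of_mem_ESet_dilate hr hPR hR.le h2.le hf i
  have hδ : 0 < ρ * ε / 2 := by positivity
  obtain ⟨t, htU, htfin, hcover⟩ :=
    Metric.finite_approx_of_totallyBounded (hU.isCompact_closure.totallyBounded.subset subset_closure)
      (ρ * ε / 2) hδ
  have hev : ∀ᶠ d : ℝ in Filter.atTop, ∀ y ∈ t, ∀ e : Fin n → ℕ,
      (∀ i, (e i : ℝ) ≤ (1 - ε) * d * y i + ρ * ε * d) →
        e ∈ ESet r ((d • P) ∩ latticePoints n) := by
    refine (Filter.eventually_all_finite htfin).2 fun y hy => ?_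
    obtain ⟨k, f, hf, rfl⟩ := Set.mem_iUnion.1 (htU hy)
    exact eventually_mem_ESet_dilate hr hc hρ hP hε0 hε1 (by positivity) hf
  obtain ⟨D, hD⟩ := Filter.eventually_atTop.1 hev
  refine ⟨max D 1, by positivity, fun d hd => ?_⟩
  have hd0 : 0 < d := by linarith [le_max_right D 1]
  refine ⟨?_, fun e he => mem_smul_SP_of_mem_ESet hr hc hρ hP hd0 he⟩
  rintro e ⟨s, hs, hse⟩
  obtain ⟨u, hu, hsu⟩ := Metric.mem_closure_iff.1 hs _ hδ
  obtain ⟨y, hy, huy⟩ := Set.mem_iUnion₂.1 (hcover hu)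
  refine hD d ((le_max_left D 1).trans hd.le) y hy e fun i => ?_
  have hi : (1 - ε) * d * s i = e i := congrFun hse i
  have hdist : dist s y ≤ ρ * ε := by
    linarith [dist_triangle s u y, Metric.mem_ball.1 huy]
  have hsy : s i - y i ≤ ρ * ε :=
    (le_abs_self _).trans ((Real.dist_eq _ _ ▸ dist_le_pi_dist s y i).trans hdist)
  have h1 : (1 - ε) * d * (s i - y i) ≤ (1 - ε) * d * (ρ * ε) :=
    mul_le_mul_of_nonneg_left hsy (mul_nonneg (by linarith) hd0.le)
  have h2 : 0 ≤ ε * d * (ρ * ε) := by positivity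
  linarith
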